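/- Let c > 0 and α > 0 be real numbers and let f : ℝ → ℝ. Assume that for every t ≥ 0, f(t) > 0, f is differentiable at t, and f'(t) ≤ −c f(t)^{1+α}. Then for every t ≥ 0, f(t) ≤ max( f(0), (c α)^{−1/α} ) · (1 + t)^{−1/α}. -/

import Mathlib

/-- The transformed quantity `f ^ (-α)` grows at least linearly along a solution of the
Bernoulli-type differential inequality `f' ≤ -c f ^ (1 + α)`. -/
theorem rpow_neg_add_mul_le_of_deriv_le {c α : ℝ} (hα : 0 < α) {f : ℝ → ℝ}
    (hf : ∀ t : ℝ, 0 ≤ t →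
      0 < f t ∧ DifferentiableAt ℝ f t ∧ deriv f t ≤ -c * f t ^ (1 + α))
    {t : ℝ} (ht : 0 ≤ t) :
    f 0 ^ (-α) + c * α * t ≤ f t ^ (-α) := by
  have hderiv : ∀ x : ℝ, 0 ≤ x →
      HasDerivAt (fun s => f s ^ (-α)) (deriv f x * (-α) * f x ^ (-α - 1)) x := fun x hx =>
    (hf x hx).2.1.hasDerivAt.rpow_const (Or.inl (hf x hx).1.ne')
  have key := (convex_Ici (0 : ℝ)).mul_sub_le_image_sub_of_le_deriv
    (f := fun s => f s ^ (-α)) (C := c * α)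
    (fun x hx => (hderiv x hx).continuousAt.continuousWithinAt)
    (fun x hx => (hderiv x (interior_subset hx)).differentiableAt.differentiableWithinAt)
    (fun x hx => by
      have hx0 : 0 ≤ x := interior_subset hx
      obtain ⟨hpos, -, hle⟩ := hf x hx0
      rw [(hderiv x hx0).deriv]
      have hmul : f x ^ (1 + α) * f x ^ (-α - 1) = 1 := by
        rw [← Real.rpow_add hpos, show 1 + α + (-α - 1) = 0 by ring, Real.rpow_zero]
      calc c * α = -c * (f x ^ (1 + α) * f x ^ (-α - 1)) * (-α) := by rw [hmul]; ring
        _ = α * f x ^ (-α - 1) * (c * f x ^ (1 + α)) := by ring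
        _ ≤ α * f x ^ (-α - 1) * -deriv f x := by
            gcongr
            linarith
        _ = deriv f x * (-α) * f x ^ (-α - 1) := by ring)
    0 Set.self_mem_Ici t ht ht
  simp only [sub_zero] at key
  linarith

/-- Polynomial decay from the Bernoulli-type differential inequality: if `f > 0` and
`f' ≤ -c f^{1+α}` on `[0,∞)`, then `f(t) ≤ max(f(0), (cα)^{-1/α}) (1+t)^{-1/α}`. -/
theorem stmt13 (c α : ℝ) (hc : 0 < c) (hα : 0 < α) (f : ℝ → ℝ)
    (hf : ∀ t : ℝ, 0 ≤ t →
      0 < f t ∧ DifferentiableAt ℝ f t ∧ deriv f t ≤ -c * f t ^ (1 + α)) :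
    ∀ t : ℝ, 0 ≤ t →
      f t ≤ max (f 0) ((c * α) ^ (-1 / α)) * (1 + t) ^ (-1 / α) := by
  intro t ht
  have hcα : 0 < c * α := mul_pos hc hα
  have h0 : 0 < f 0 := (hf 0 le_rfl).1
  have hexp : -1 / α * -α = 1 := by field_simp
  set M := max (f 0) ((c * α) ^ (-1 / α))
  have hM : 0 < M := lt_max_of_lt_left h0
  have hM0 : M ^ (-α) ≤ f 0 ^ (-α) :=
    Real.rpow_le_rpow_of_nonpos h0 (le_max_left _ _) (by linarith)
  have hMc : M ^ (-α) ≤ c * α := by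
    have h := Real.rpow_le_rpow_of_nonpos (z := -α) (Real.rpow_pos_of_pos hcα _)
      (le_max_right (f 0) ((c * α) ^ (-1 / α))) (by linarith)
    rwa [← Real.rpow_mul hcα.le, hexp, Real.rpow_one] at h
  have ht1 : 0 < 1 + t := by linarith
  rw [← Real.rpow_le_rpow_iff_of_neg (mul_pos hM (Real.rpow_pos_of_pos ht1 _)) (hf t ht).1
    (neg_lt_zero.mpr hα), Real.mul_rpow hM.le (Real.rpow_nonneg ht1.le _),
    ← Real.rpow_mul ht1.le, hexp, Real.rpow_one]
  calc M ^ (-α) * (1 + t) = M ^ (-α) + M ^ (-α) * t := by ring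
    _ ≤ f 0 ^ (-α) + c * α * t := by gcongr
    _ ≤ f t ^ (-α) := rpow_neg_add_mul_le_of_deriv_le hα hf ht
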